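/- (Lemma 3.5.) For every integer m, every integer j ≥ 1 and every partition μ, one has Y_{m+1}(μ) · Y_m(μ↓j)^{−1} = Y(|μ| − |μ↓j| + m, |μ| − |μ↓j|). -/

import Mathlib

/-- A partition, recorded by its parts: `f k` is the `(k+1)`-st part `λ_{k+1}`
(0-indexed), so the parts are weakly decreasing and eventually zero. -/
def IsPartition (f : ℕ → ℕ) : Prop :=
  (∀ k, f (k + 1) ≤ f k) ∧ ∃ N, f N = 0

/-- `|λ|`, the size (sum of the parts) of a partition. -/
noncomputable def psize (f : ℕ → ℕ) : ℕ := ∑' k, f k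

/-- `ℓ(λ)`, the number of nonzero parts of a partition. -/
noncomputable def plength (f : ℕ → ℕ) : ℕ := Set.ncard {k | f k ≠ 0}

/-- `u_i(λ)`, the number of parts of `λ` that are `≥ i`. -/
noncomputable def ucount (f : ℕ → ℕ) (i : ℕ) : ℕ := Set.ncard {k | i ≤ f k}

/-- `λ↑i`: the parts `λ_1,…,λ_{u_i(λ)}` each lose one, a new part `i - 1` is inserted
at (1-indexed) position `u_i(λ) + 1`, and the remaining parts are unchanged
(trailing zeros are irrelevant in this representation). -/
noncomputable def upP (f : ℕ → ℕ) (i : ℕ) : ℕ → ℕ := fun k =>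
  if k < ucount f i then f k - 1
  else if k = ucount f i then i - 1
  else f (k - 1)

/-- `λ↓j`: the (1-indexed) part `λ_j` is removed and the parts before it each gain one
(trailing zeros are irrelevant in this representation). -/
def downP (f : ℕ → ℕ) (j : ℕ) : ℕ → ℕ := fun k =>
  if k + 1 < j then f k + 1 else f (k + 1)

variable {G : Type*} [CommGroup G]

/-- The shifted product `Y(m,k)`: `∏_{j=1}^{k} y_{m+1-j}` for `k ≥ 1`, `1` for `k = 0`,
and `Y(m-k,-k)⁻¹` for `k ≤ -1`. -/
noncomputable def Yfun (y : ℤ → G) (m k : ℤ) : G :=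
  if 1 ≤ k then ∏ j ∈ Finset.range k.toNat, y (m - j)
  else if k = 0 then 1
  else (∏ j ∈ Finset.range (-k).toNat, y (m - k - j))⁻¹

/-- The shifted content product `Y_n(λ) = ∏_{i=1}^{ℓ(λ)} Y(λ_i - i + n, λ_i)`. -/
noncomputable def Ynl (y : ℤ → G) (f : ℕ → ℕ) (n : ℤ) : G :=
  ∏ k ∈ Finset.range (plength f), Yfun y ((f k : ℤ) - ((k : ℤ) + 1) + n) (f k)

theorem prod_range_succ_eq_mul_prod_skip {M : Type*} [CommMonoid M] (a : ℕ → M) {p n : ℕ}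
    (h : p ≤ n) :
    ∏ k ∈ Finset.range (n + 1), a k =
      a p * ∏ k ∈ Finset.range n, a (if k < p then k else k + 1) := by
  induction n, h using Nat.le_induction with
  | base =>
    rw [Finset.prod_range_succ, mul_comm]
    congr 1
    exact Finset.prod_congr rfl fun k hk => by rw [if_pos (Finset.mem_range.1 hk)]
  | succ n hn ih =>
    rw [Finset.prod_range_succ, ih, Finset.prod_range_succ _ n, if_neg (by lia), mul_assoc]

theorem sum_range_succ_eq_add_sum_skip {M : Type*} [AddCommMonoid M] (a : ℕ → M) {p n : ℕ}
    (h : p ≤ n) :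
    ∑ k ∈ Finset.range (n + 1), a k =
      a p + ∑ k ∈ Finset.range n, a (if k < p then k else k + 1) :=
  prod_range_succ_eq_mul_prod_skip (M := Multiplicative M) a h

theorem IsPartition.antitone {f : ℕ → ℕ} (hf : IsPartition f) : Antitone f :=
  antitone_nat_of_succ_le hf.1

theorem IsPartition.eq_zero_of_le {f : ℕ → ℕ} (hf : IsPartition f) {N k : ℕ} (hN : f N = 0)
    (hk : N ≤ k) : f k = 0 :=
  Nat.le_zero.1 (hN ▸ hf.antitone hk)

theorem IsPartition.downP {f : ℕ → ℕ} (hf : IsPartition f) (j : ℕ) :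
    IsPartition (downP f j) := by
  obtain ⟨hmono, N, hN⟩ := hf
  refine ⟨fun k => ?_, N + j, ?_⟩
  · have h₁ := hmono k
    have h₂ := hmono (k + 1)
    unfold _root_.downP
    split_ifs <;> lia
  · rw [_root_.downP, if_neg (by lia)]
    exact IsPartition.eq_zero_of_le ⟨hmono, N, hN⟩ hN (by lia)

theorem IsPartition.lt_plength_iff {f : ℕ → ℕ} (hf : IsPartition f) (k : ℕ) :
    k < plength f ↔ f k ≠ 0 := by
  classical
  have hset : {k | f k ≠ 0} = ↑(Finset.range (Nat.find hf.2)) := by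
    ext i
    simp only [Set.mem_ofPred_eq, Finset.coe_range, Set.mem_Iio]
    refine ⟨fun h => ?_, fun h => Nat.find_min hf.2 h⟩
    by_contra hi
    exact h (hf.eq_zero_of_le (Nat.find_spec hf.2) (not_lt.1 hi))
  have hlen : plength f = Nat.find hf.2 := by
    rw [plength, hset, Set.ncard_coe_finset, Finset.card_range]
  rw [hlen, ← Finset.mem_range, ← Finset.mem_coe, ← hset, Set.mem_ofPred_eq]

theorem IsPartition.psize_eq_sum {f : ℕ → ℕ} (hf : IsPartition f) {N : ℕ} (hN : f N = 0) :
    psize f = ∑ k ∈ Finset.range N, f k :=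
  tsum_eq_sum fun _ hk => hf.eq_zero_of_le hN (by simpa using hk)

theorem IsPartition.Ynl_eq_prod (y : ℤ → G) {f : ℕ → ℕ}
    (hf : IsPartition f) (n : ℤ) {N : ℕ} (hN : f N = 0) :
    Ynl y f n = ∏ k ∈ Finset.range N, Yfun y ((f k : ℤ) - ((k : ℤ) + 1) + n) (f k) := by
  refine Finset.prod_subset (fun k hk => ?_) fun k _ hk => ?_
  · rw [Finset.mem_range, hf.lt_plength_iff] at hk
    by_contra h
    exact hk (hf.eq_zero_of_le hN (by simpa using h))
  · rw [Finset.mem_range, hf.lt_plength_iff, not_not] at hk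
    simp [hk, Yfun]

theorem exists_primitive (y : ℤ → G) :
    ∃ F : ℤ → G, ∀ n, y n = F n / F (n - 1) := by
  refine ⟨fun n => (∏ i ∈ Finset.range n.toNat, y (i + 1)) /
    ∏ i ∈ Finset.range (-n).toNat, y (-i), fun n => ?_⟩
  rcases lt_or_ge 0 n with h | h
  · obtain ⟨k, rfl⟩ : ∃ k : ℕ, n = k + 1 := ⟨(n - 1).toNat, by lia⟩
    have h₁ : ((k : ℤ) + 1).toNat = k + 1 := by lia
    have h₂ : (-((k : ℤ) + 1)).toNat = 0 := by lia
    simp only [h₁, h₂, Finset.prod_range_succ, add_sub_cancel_right]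
    simp
  · obtain ⟨k, rfl⟩ : ∃ k : ℕ, n = -k := ⟨(-n).toNat, by lia⟩
    have h₁ : (-(k : ℤ) - 1).toNat = 0 := by lia
    have h₂ : (-(-(k : ℤ) - 1)).toNat = k + 1 := by lia
    simp only [h₁, h₂, neg_neg, Finset.prod_range_succ]
    simp

theorem Yfun_eq_div {y F : ℤ → G} (hF : ∀ n, y n = F n / F (n - 1))
    (m k : ℤ) : Yfun y m k = F m / F (m - k) := by
  have key (m : ℤ) (n : ℕ) : ∏ j ∈ Finset.range n, y (m - j) = F m / F (m - n) := by
    have := Finset.prod_range_div' (fun j : ℕ => F (m - j)) n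
    simpa [hF, sub_sub] using this
  unfold Yfun
  split_ifs with h₁ h₂
  · rw [key, Int.toNat_of_nonneg (by lia)]
  · simp [h₂]
  · rw [key, Int.toNat_of_nonneg (by lia), inv_div]
    congr 2
    ring

/-- Lemma 3.5: for every integer `m`, every integer `j ≥ 1` and every partition `μ`,
`Y_{m+1}(μ) Y_m(μ↓j)⁻¹ = Y(|μ| - |μ↓j| + m, |μ| - |μ↓j|)`. -/
theorem Ynl_downP_ratio {G : Type*} [CommGroup G] (y : ℤ → G) (m : ℤ)
    (g : ℕ → ℕ) (hg : IsPartition g) (j : ℕ) (hj : 1 ≤ j) :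
    Ynl y g (m + 1) * (Ynl y (downP g j) m)⁻¹ =
      Yfun y ((psize g : ℤ) - (psize (downP g j) : ℤ) + m)
        ((psize g : ℤ) - (psize (downP g j) : ℤ)) := by
  obtain ⟨p, rfl⟩ : ∃ p, j = p + 1 := ⟨j - 1, by lia⟩
  obtain ⟨F, hF⟩ := exists_primitive y
  obtain ⟨N, hN⟩ := hg.2
  set M := N + p
  have hpM : p ≤ M := Nat.le_add_left _ _
  have hgM : g (M + 1) = 0 := hg.eq_zero_of_le hN (by lia)
  have hdM : downP g (p + 1) M = 0 := by rw [downP, if_neg (by lia), hgM]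
  have hd := hg.downP (p + 1)
  let b : ℕ → ℤ := fun k => g k - k
  have hb (k : ℕ) :
      b (if k < p then k else k + 1) = (downP g (p + 1) k : ℤ) - ((k : ℤ) + 1) := by
    simp only [b, downP, Nat.add_lt_add_iff_right]
    split_ifs <;> push_cast <;> ring
  have hsize : (psize g : ℤ) - psize (downP g (p + 1)) = b p := by
    have hsum := sum_range_succ_eq_add_sum_skip b hpM
    simp only [hb] at hsum
    simp only [b, Finset.sum_sub_distrib] at hsum
    rw [Finset.sum_range_succ' (fun k : ℕ => (k : ℤ))] at hsum
    rw [hg.psize_eq_sum hgM, hd.psize_eq_sum hdM]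
    push_cast at hsum ⊢
    simp only [b]
    linarith
  have hprod := prod_range_succ_eq_mul_prod_skip (fun k => F (b k + m)) hpM
  simp only [hb] at hprod
  have hYg : Ynl y g (m + 1) = (∏ k ∈ Finset.range (M + 1), F (b k + m)) /
      ∏ k ∈ Finset.range (M + 1), F (m - k) := by
    rw [hg.Ynl_eq_prod y _ hgM, ← Finset.prod_div_distrib]
    refine Finset.prod_congr rfl fun k _ => ?_
    rw [Yfun_eq_div hF]
    simp only [b]
    congr 2 <;> ring
  have hYd : Ynl y (downP g (p + 1)) m =
      (∏ k ∈ Finset.range M, F ((downP g (p + 1) k : ℤ) - ((k : ℤ) + 1) + m)) /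
        ∏ k ∈ Finset.range M, F (m - (k + 1 : ℕ)) := by
    rw [hd.Ynl_eq_prod y _ hdM, ← Finset.prod_div_distrib]
    refine Finset.prod_congr rfl fun k _ => ?_
    rw [Yfun_eq_div hF]
    congr 2
    push_cast
    ring
  rw [hsize, Yfun_eq_div hF, hYg, hYd, hprod, Finset.prod_range_succ' (fun k : ℕ => F (m - k)),
    add_sub_cancel_left, Nat.cast_zero, sub_zero, mul_comm _ (F m), mul_div_mul_comm,
    mul_inv_cancel_right]
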